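/- Let f₁, g₁ be real polynomials and let z ∈ ℝ satisfy g₁(z) = 0, g₁′(z) ≠ 0 (z is a simple root of g₁), and f₁(z) ≠ 0. Then for every ε > 0 there exists M > 0 such that for every μ > M there exists x ∈ ℝ with |x − z| < ε and f₁(x) + μ·g₁(x) = 0; that is, the equilibrium branches of f₁ + μg₁ = 0 approach the zero z as μ → +∞ (horizontal asymptote at the zero). -/

import Mathlib

open Polynomial

lemma aux_pos (f g : Polynomial ℝ) (z : ℝ)
    (hz : g.eval z = 0) (hz' : 0 < (Polynomial.derivative g).eval z) (ε : ℝ) (hε : 0 < ε) :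
    ∃ M : ℝ, M > 0 ∧ ∀ μ : ℝ, μ > M → ∃ x : ℝ,
      |x - z| < ε ∧ f.eval x + μ * g.eval x = 0 := by
  obtain ⟨q, rfl⟩ := Polynomial.dvd_iff_isRoot.mpr hz
  have hq : 0 < q.eval z := by simpa [Polynomial.derivative_mul] using hz'
  have hev : ∀ᶠ x in nhds z, 0 < q.eval x :=
    q.continuous.continuousAt.eventually (lt_mem_nhds hq)
  obtain ⟨δ, hδ, hb⟩ := Metric.eventually_nhds_iff.mp hev
  obtain ⟨r, hr, hrm⟩ : ∃ r : ℝ, 0 < r ∧ r < min δ ε := exists_between (lt_min hδ hε)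
  have hrδ : r < δ := hrm.trans_le (min_le_left _ _)
  have hrε : r < ε := hrm.trans_le (min_le_right _ _)
  have ha : 0 < q.eval (z - r) := hb (by simpa [Real.dist_eq, abs_of_pos hr] using hrδ)
  have hb' : 0 < q.eval (z + r) := hb (by simpa [Real.dist_eq, abs_of_pos hr] using hrδ)
  have hA : 0 < r * q.eval (z - r) := mul_pos hr ha
  have hB : 0 < r * q.eval (z + r) := mul_pos hr hb'
  have h1 := div_nonneg (abs_nonneg (f.eval (z - r))) hA.le
  have h2 := div_nonneg (abs_nonneg (f.eval (z + r))) hB.le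
  refine ⟨|f.eval (z - r)| / (r * q.eval (z - r)) + |f.eval (z + r)| / (r * q.eval (z + r)) + 1,
    by linarith, fun μ hμ => ?_⟩
  have h3 := (div_lt_iff₀ hA).mp (show |f.eval (z - r)| / (r * q.eval (z - r)) < μ by linarith)
  have h4 := (div_lt_iff₀ hB).mp (show |f.eval (z + r)| / (r * q.eval (z + r)) < μ by linarith)
  have h5 := le_abs_self (f.eval (z - r))
  have h6 := neg_abs_le (f.eval (z + r))
  have hc : ContinuousOn (fun x => f.eval x + μ * ((X - C z) * q).eval x)
      (Set.Icc (z - r) (z + r)) := by fun_prop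
  obtain ⟨x, hx, hx0⟩ := intermediate_value_Icc (by linarith) hc
    (show (0 : ℝ) ∈ _ from by
      constructor
      · simp only [eval_mul, eval_sub, eval_X, eval_C]
        ring_nf at *
        linarith
      · simp only [eval_mul, eval_sub, eval_X, eval_C]
        ring_nf at *
        linarith)
  refine ⟨x, ?_, hx0⟩
  rw [abs_lt]
  constructor <;> linarith [hx.1, hx.2]

theorem stmt_9 (f₁ g₁ : Polynomial ℝ) (z : ℝ)
    (hz : g₁.eval z = 0) (hz' : (Polynomial.derivative g₁).eval z ≠ 0)
    (hfz : f₁.eval z ≠ 0) :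
    ∀ ε > 0, ∃ M > 0, ∀ μ > M, ∃ x : ℝ,
      |x - z| < ε ∧ f₁.eval x + μ * g₁.eval x = 0 := by
  intro ε hε
  rcases lt_or_gt_of_ne hz' with h | h
  · obtain ⟨M, hM, H⟩ := aux_pos (-f₁) (-g₁) z (by simpa using hz) (by simpa using h) ε hε
    refine ⟨M, hM, fun μ hμ => ?_⟩
    obtain ⟨x, hx, hx0⟩ := H μ hμ
    refine ⟨x, hx, ?_⟩
    simp only [eval_neg] at hx0
    linarith
  · exact aux_pos f₁ g₁ z hz h ε hε
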